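/- arXiv:2211.08427 — 6 statements merged into one kernel-verified Lean document; each statement's English description precedes it below -/
import Mathlib

section
/- The union of the two children equals the parent simplex: conv{p₀, p₁, …, pₙ} = conv{p₀, z, p₂, …, pₙ} ∪ conv{z, p₁, p₂, …, pₙ}. -/
open Set

/-- Replacing a point of a family by a point of its convex hull does not enlarge the hull. -/
theorem convexHull_range_update_subset {ι 𝕜 E : Type*} [DecidableEq ι]
    [Semiring 𝕜] [PartialOrder 𝕜] [AddCommMonoid E] [Module 𝕜 E] (p : ι → E) (j : ι)
    {z : E} (hz : z ∈ convexHull 𝕜 (range p)) :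
    convexHull 𝕜 (range (Function.update p j z)) ⊆ convexHull 𝕜 (range p) := by
  refine convexHull_min ?_ (convex_convexHull 𝕜 _)
  rintro _ ⟨k, rfl⟩
  rcases eq_or_ne k j with rfl | hk
  · simpa using hz
  · simpa [hk] using subset_convexHull 𝕜 _ (mem_range_self k)

section Bisection

variable {ι 𝕜 E : Type*} [Fintype ι] [Field 𝕜] [LinearOrder 𝕜] [IsStrictOrderedRing 𝕜]
  [AddCommGroup E] [Module 𝕜 E]

/-- A convex combination lies in the convex hull of the family. -/
theorem sum_smul_mem_convexHull_range (p : ι → E) {w : ι → 𝕜} (hw : ∀ k, 0 ≤ w k)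
    (hw1 : ∑ k, w k = 1) : ∑ k, w k • p k ∈ convexHull 𝕜 (range p) :=
  (convex_convexHull 𝕜 _).sum_mem (fun k _ => hw k) hw1
    fun k _ => subset_convexHull 𝕜 _ (mem_range_self k)

/-- Every point of the convex hull of a finite family is a convex combination of it. -/
theorem exists_sum_smul_of_mem_convexHull_range {p : ι → E} {x : E}
    (hx : x ∈ convexHull 𝕜 (range p)) :
    ∃ w : ι → 𝕜, (∀ k, 0 ≤ w k) ∧ ∑ k, w k = 1 ∧ ∑ k, w k • p k = x := by
  classical
  have hp : range p = Fintype.linearCombination 𝕜 p '' range fun i : ι => Pi.single i (1 : 𝕜) := by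
    rw [← range_comp]
    congr 1
    ext i
    simp
  rw [hp, ← LinearMap.image_convexHull, convexHull_rangle_single_eq_stdSimplex] at hx
  obtain ⟨w, hw, rfl⟩ := hx
  exact ⟨w, hw.1, hw.2, rfl⟩

variable [DecidableEq ι]

/-- A convex combination with `w j ≤ w i` remains in the hull after replacing `p j` by the
midpoint of `p i` and `p j`. -/
theorem sum_smul_mem_convexHull_range_update_midpoint (p : ι → E) {i j : ι} (hij : i ≠ j)
    {w : ι → 𝕜} (hw : ∀ k, 0 ≤ w k) (hw1 : ∑ k, w k = 1) (hji : w j ≤ w i) :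
    ∑ k, w k • p k ∈ convexHull 𝕜 (range (Function.update p j (midpoint 𝕜 (p i) (p j)))) := by
  set q := Function.update p j (midpoint 𝕜 (p i) (p j)) with hq
  have hp : p = q + Pi.single j (q j - q i) := by
    funext k
    rcases eq_or_ne k j with rfl | hk
    · have h := midpoint_add_self 𝕜 (p i) (p k)
      simp only [hq, Pi.add_apply, Pi.single_eq_same, Function.update_self,
        Function.update_of_ne hij, ← add_sub_assoc, h]
      abel
    · simp [hq, hk]
  have hsum : ∑ k, w k • p k =
      ∑ k, (w k + w j * ((Pi.single j 1 : ι → 𝕜) k - (Pi.single i 1 : ι → 𝕜) k)) • q k := by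
    rw [hp]
    simp [add_smul, mul_smul, sub_smul, Finset.sum_add_distrib, ← Finset.smul_sum,
      Finset.sum_sub_distrib, Pi.single_apply, ite_smul, smul_ite]
  rw [hsum]
  refine sum_smul_mem_convexHull_range q (fun k => ?_) ?_
  · rcases eq_or_ne k i with rfl | hki
    · simpa [hij] using hji
    · rw [Pi.single_eq_of_ne hki, sub_zero]
      have : (0 : 𝕜) ≤ (Pi.single j 1 : ι → 𝕜) k := by
        rw [Pi.single_apply]; split_ifs <;> simp
      exact add_nonneg (hw k) (mul_nonneg (hw j) this)
  · simp [Finset.sum_add_distrib, ← Finset.mul_sum, Finset.sum_sub_distrib, hw1]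

/-- Bisecting a finite family at the midpoint of two of its points splits its convex hull. -/
theorem convexHull_range_eq_union_update_midpoint (p : ι → E) {i j : ι} (hij : i ≠ j) :
    convexHull 𝕜 (range p) =
      convexHull 𝕜 (range (Function.update p j (midpoint 𝕜 (p i) (p j)))) ∪
      convexHull 𝕜 (range (Function.update p i (midpoint 𝕜 (p i) (p j)))) := by
  apply Subset.antisymm
  · intro x hx
    obtain ⟨w, hw, hw1, rfl⟩ := exists_sum_smul_of_mem_convexHull_range hx
    rcases le_total (w j) (w i) with h | h
    · exact Or.inl (sum_smul_mem_convexHull_range_update_midpoint p hij hw hw1 h)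
    · rw [midpoint_comm (p i) (p j)]
      exact Or.inr (sum_smul_mem_convexHull_range_update_midpoint p hij.symm hw hw1 h)
  · have hz : midpoint 𝕜 (p i) (p j) ∈ convexHull 𝕜 (range p) :=
      (convex_convexHull 𝕜 _).midpoint_mem (subset_convexHull 𝕜 _ (mem_range_self i))
        (subset_convexHull 𝕜 _ (mem_range_self j))
    exact union_subset (convexHull_range_update_subset p j hz)
      (convexHull_range_update_subset p i hz)

end Bisection

/-- The union of the two children of a bisection equals the parent simplex:
`conv{p₀, p₁, …, pₙ} = conv{p₀, z, p₂, …, pₙ} ∪ conv{z, p₁, p₂, …, pₙ}`,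
where `z = (p₀ + p₁)/2`. -/
theorem bisection_union (n : ℕ) (hn : 1 ≤ n)
    (p : Fin (n+1) → EuclideanSpace ℝ (Fin n)) (hp : AffineIndependent ℝ p) :
    convexHull ℝ (Set.range p) =
      convexHull ℝ (Set.range (Function.update p 1 (midpoint ℝ (p 0) (p 1)))) ∪
      convexHull ℝ (Set.range (Function.update p 0 (midpoint ℝ (p 0) (p 1)))) := by
  have : NeZero n := ⟨by omega⟩
  exact convexHull_range_eq_union_update_midpoint p Fin.zero_ne_one'
end

section
/- The two children of the bisection intersect exactly in their common face: conv{p₀, z, p₂, …, pₙ} ∩ conv{z, p₁, p₂, …, pₙ} = conv{z, p₂, …, pₙ}. -/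
open Set

section

variable {ι E : Type*} [Fintype ι] [AddCommGroup E] [Module ℝ E]

theorem exists_weights_of_mem_convexHull_range {v : ι → E} {x : E}
    (hx : x ∈ convexHull ℝ (range v)) :
    ∃ w : ι → ℝ, (∀ i, 0 ≤ w i) ∧ ∑ i, w i = 1 ∧ ∑ i, w i • v i = x := by
  classical
  rw [convexHull_range_eq_exists_affineCombination] at hx
  obtain ⟨s, w, hw₀, hw₁, rfl⟩ := hx
  refine ⟨fun i ↦ if i ∈ s then w i else 0, fun i ↦ ?_, ?_, ?_⟩
  · dsimp only
    split_ifs with hi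
    exacts [hw₀ i hi, le_rfl]
  · simpa using hw₁
  · simp [ite_smul, s.affineCombination_eq_linear_combination v w hw₁]

theorem sum_smul_update [DecidableEq ι] (p : ι → E) (w : ι → ℝ) (j : ι) (m : E) :
    ∑ k, w k • Function.update p j m k = ∑ k, w k • p k + w j • (m - p j) := by
  have h (k : ι) : w k • Function.update p j m k =
      w k • p k + if k = j then w j • (m - p j) else 0 := by
    by_cases hk : k = j
    · subst hk; simp [smul_sub]
    · simp [hk]
  simp_rw [h, Finset.sum_add_distrib]
  simp

/-- In a common point of the two children, the vertex outside the common face has weight zero. -/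
theorem AffineIndependent.weight_eq_zero_of_bisection [DecidableEq ι] {p : ι → E}
    (hp : AffineIndependent ℝ p) {i j : ι} (hij : i ≠ j) {w v : ι → ℝ}
    (hw₀ : ∀ k, 0 ≤ w k) (hv₀ : ∀ k, 0 ≤ v k) (hwv : ∑ k, w k = ∑ k, v k)
    (h : ∑ k, w k • Function.update p j (midpoint ℝ (p i) (p j)) k =
      ∑ k, v k • Function.update p i (midpoint ℝ (p i) (p j)) k) : w i = 0 := by
  let c : ℝ := (w j + v i) / 2
  let d : ι → ℝ := Pi.single i c - Pi.single j c
  have hd : ∑ k, d k • p k = c • (p i - p j) := by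
    simp [d, sub_smul, Finset.sum_sub_distrib, Pi.single_apply, ite_smul, smul_sub]
  have hsum : ∑ k, (w k + d k) = ∑ k, v k := by
    simp [d, Finset.sum_add_distrib, Finset.sum_sub_distrib, hwv]
  have hcomb : ∑ k, (w k + d k) • p k = ∑ k, v k • p k := by
    rw [sum_smul_update, sum_smul_update, midpoint_eq_smul_add] at h
    simp only [add_smul, Finset.sum_add_distrib, hd]
    rw [← sub_eq_zero] at h ⊢
    rw [← h]
    simp only [c, invOf_eq_inv]
    module
  have key := hp.eq_of_sum_eq_sum hsum hcomb
  have hi := key i (Finset.mem_univ i)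
  have hj := key j (Finset.mem_univ j)
  simp only [d, c, Pi.sub_apply, Pi.single_eq_same, Pi.single_eq_of_ne hij,
    Pi.single_eq_of_ne hij.symm] at hi hj
  linarith [hw₀ i, hv₀ j]

theorem AffineIndependent.convexHull_bisection_inter [DecidableEq ι] {p : ι → E}
    (hp : AffineIndependent ℝ p) {i j : ι} (hij : i ≠ j) :
    convexHull ℝ (range (Function.update p j (midpoint ℝ (p i) (p j)))) ∩
      convexHull ℝ (range (Function.update p i (midpoint ℝ (p i) (p j)))) =
    convexHull ℝ (insert (midpoint ℝ (p i) (p j)) (p '' {k | k ≠ i ∧ k ≠ j})) := by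
  apply Subset.antisymm
  · rintro x ⟨hxw, hxv⟩
    obtain ⟨w, hw₀, hw₁, rfl⟩ := exists_weights_of_mem_convexHull_range hxw
    obtain ⟨v, hv₀, hv₁, hv⟩ := exists_weights_of_mem_convexHull_range hxv
    have hwi := hp.weight_eq_zero_of_bisection hij hw₀ hv₀ (hw₁.trans hv₁.symm) hv.symm
    rw [← Finset.sum_erase Finset.univ (a := i) (by simp [hwi])]
    rw [← Finset.sum_erase Finset.univ (a := i) hwi] at hw₁
    refine (convex_convexHull ℝ _).sum_mem (fun k _ ↦ hw₀ k) hw₁ fun k hk ↦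
      subset_convexHull ℝ _ ?_
    by_cases hkj : k = j
    · subst hkj; simp
    · rw [Function.update_of_ne hkj]
      exact Or.inr ⟨k, ⟨Finset.ne_of_mem_erase hk, hkj⟩, rfl⟩
  · refine subset_inter (convexHull_mono ?_) (convexHull_mono ?_) <;>
      rintro _ (rfl | ⟨k, ⟨hki, hkj⟩, rfl⟩)
    exacts [⟨j, by simp⟩, ⟨k, by simp [hkj]⟩, ⟨i, by simp⟩, ⟨k, by simp [hki]⟩]

end

/-- The two children of the bisection intersect exactly in their common face:
`conv{p₀, z, p₂, …, pₙ} ∩ conv{z, p₁, p₂, …, pₙ} = conv{z, p₂, …, pₙ}`,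
where `z = (p₀ + p₁)/2`. -/
theorem bisection_children_inter_eq_common_face (n : ℕ) (hn : 1 ≤ n)
    (p : Fin (n+1) → EuclideanSpace ℝ (Fin n)) (hp : AffineIndependent ℝ p) :
    convexHull ℝ (Set.range (Function.update p 1 (midpoint ℝ (p 0) (p 1)))) ∩
      convexHull ℝ (Set.range (Function.update p 0 (midpoint ℝ (p 0) (p 1)))) =
    convexHull ℝ
      (insert (midpoint ℝ (p 0) (p 1)) (p '' {i : Fin (n+1) | i ≠ 0 ∧ i ≠ 1})) := by
  have h01 : (0 : Fin (n + 1)) ≠ 1 := by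
    rw [Ne, Fin.zero_eq_one_iff]
    lia
  exact hp.convexHull_bisection_inter h01
end

section
/- The interiors of the two children of the bisection are disjoint: interior(conv{p₀, z, p₂, …, pₙ}) ∩ interior(conv{z, p₁, p₂, …, pₙ}) = ∅. -/
open Set

/-- The convex hull of a set on which an affine map is nonnegative lies in its nonnegative
half-space. -/
theorem convexHull_subset_nonneg_of_affineMap {E : Type*} [AddCommGroup E] [Module ℝ E]
    (f : E →ᵃ[ℝ] ℝ) {s : Set E} (hs : ∀ x ∈ s, 0 ≤ f x) :
    ∀ x ∈ convexHull ℝ s, 0 ≤ f x :=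
  fun _ hx => convexHull_min (t := f ⁻¹' Ici 0) hs ((convex_Ici 0).affine_preimage f) hx

/-- If a surjective affine functional is nonnegative on one set and nonpositive on another, then
the interiors of the two sets are disjoint. -/
theorem interior_inter_interior_eq_empty_of_affineMap {E : Type*} [NormedAddCommGroup E]
    [NormedSpace ℝ E] [FiniteDimensional ℝ E] (f : E →ᵃ[ℝ] ℝ) (hf : Function.Surjective f)
    {s t : Set E} (hs : ∀ x ∈ s, 0 ≤ f x) (ht : ∀ x ∈ t, f x ≤ 0) :
    interior s ∩ interior t = ∅ := by
  by_contra h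
  have hne : (interior s ∩ interior t).Nonempty := nonempty_iff_ne_empty.mpr h
  have hopen : IsOpen (f '' (interior s ∩ interior t)) :=
    f.isOpenMap f.continuous_of_finiteDimensional hf _
      (isOpen_interior.inter isOpen_interior)
  have himage : f '' (interior s ∩ interior t) = {0} := by
    refine (hne.image f).subset_singleton_iff.mp ?_
    rintro _ ⟨x, ⟨hxs, hxt⟩, rfl⟩
    exact le_antisymm (ht x (interior_subset hxt)) (hs x (interior_subset hxs))
  exact not_isOpen_singleton (0 : ℝ) (himage ▸ hopen)

/-- The interiors of the two children of the bisection are disjoint: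
`interior(conv{p₀, z, p₂, …, pₙ}) ∩ interior(conv{z, p₁, p₂, …, pₙ}) = ∅`,
where `z = (p₀ + p₁)/2`. -/
theorem bisection_children_interiors_disjoint (n : ℕ) (hn : 1 ≤ n)
    (p : Fin (n+1) → EuclideanSpace ℝ (Fin n)) (hp : AffineIndependent ℝ p) :
    interior (convexHull ℝ (Set.range (Function.update p 1 (midpoint ℝ (p 0) (p 1))))) ∩
      interior (convexHull ℝ (Set.range (Function.update p 0 (midpoint ℝ (p 0) (p 1))))) =
    ∅ := by
  obtain ⟨m, rfl⟩ : ∃ m, n = m + 1 := ⟨n - 1, by omega⟩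
  have htop : affineSpan ℝ (range p) = ⊤ :=
    hp.affineSpan_eq_top_iff_card_eq_finrank_add_one.mpr (by simp)
  let b : AffineBasis (Fin (m + 1 + 1)) ℝ (EuclideanSpace ℝ (Fin (m + 1))) := ⟨p, hp, htop⟩
  let f : EuclideanSpace ℝ (Fin (m + 1)) →ᵃ[ℝ] ℝ := b.coord 0 - b.coord 1
  have hfp (i : Fin (m + 1 + 1)) :
      f (p i) = (if 0 = i then 1 else 0) - (if 1 = i then 1 else 0) :=
    congrArg₂ (· - ·) (b.coord_apply 0 i) (b.coord_apply 1 i)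
  have hf0 : f (p 0) = 1 := by simp [hfp]
  have hf1 : f (p 1) = -1 := by simp [hfp]
  have hfz : f (midpoint ℝ (p 0) (p 1)) = 0 := by
    rw [f.map_midpoint, hf0, hf1, midpoint_self_neg]
  have hsurj : Function.Surjective f := by
    intro y
    refine ⟨AffineMap.lineMap (p 0) (p 1) ((1 - y) / 2), ?_⟩
    rw [f.apply_lineMap, hf0, hf1, AffineMap.lineMap_apply_ring']
    ring
  refine interior_inter_interior_eq_empty_of_affineMap f hsurj
    (convexHull_subset_nonneg_of_affineMap f ?_) fun x hx => neg_nonneg.mp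
      (convexHull_subset_nonneg_of_affineMap (-f) ?_ x hx)
  · rintro _ ⟨i, rfl⟩
    obtain rfl | hi := eq_or_ne i 1
    · simp [hfz]
    · rw [Function.update_of_ne hi, hfp, if_neg hi.symm]
      split_ifs <;> norm_num
  · rintro _ ⟨i, rfl⟩
    obtain rfl | hi := eq_or_ne i 0
    · rw [Function.update_self, AffineMap.coe_neg, Pi.neg_apply, hfz, neg_zero]
    · rw [Function.update_of_ne hi, AffineMap.coe_neg, Pi.neg_apply, hfp, if_neg hi.symm]
      split_ifs <;> norm_num
end

section
/- The children of the bisection are the intersections of the parent with two complementary half-spaces: there exists an affine map f : ℝⁿ → ℝ with f(z) = 0, f(pᵢ) = 0 for all 2 ≤ i ≤ n, f(p₀) > 0 and f(p₁) < 0, such that conv{p₀, z, p₂, …, pₙ} = conv{p₀, …, pₙ} ∩ {x : f(x) ≥ 0} and conv{z, p₁, p₂, …, pₙ} = conv{p₀, …, pₙ} ∩ {x : f(x) ≤ 0}. -/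
open Set

/-- Replacing the vertex `b j` of a simplex by the midpoint of the edge from `b i` to `b j`
cuts the simplex with the half-space where the `j`-th barycentric coordinate is at most the
`i`-th one. -/
theorem AffineBasis.convexHull_range_update_midpoint {ι E : Type*} [Fintype ι] [DecidableEq ι]
    [AddCommGroup E] [Module ℝ E] (b : AffineBasis ι ℝ E) {i j : ι} (hij : i ≠ j) :
    convexHull ℝ (range (Function.update b j (midpoint ℝ (b i) (b j)))) =
      convexHull ℝ (range b) ∩ {x | 0 ≤ (b.coord i - b.coord j) x} := by
  apply Subset.antisymm
  · refine convexHull_min ?_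
      ((convex_convexHull ℝ _).inter ((convex_Ici (0 : ℝ)).affine_preimage _))
    have hmem (k : ι) : b k ∈ convexHull ℝ (range b) := subset_convexHull ℝ _ ⟨k, rfl⟩
    rintro _ ⟨k, rfl⟩
    rcases eq_or_ne k j with rfl | hk
    · rw [Function.update_self]
      refine ⟨(convex_convexHull ℝ _).midpoint_mem (hmem i) (hmem k), ?_⟩
      have hmid : (b.coord i - b.coord k) (midpoint ℝ (b i) (b k)) = 0 := by
        rw [AffineMap.map_midpoint]
        simp [hij, hij.symm, midpoint_eq_smul_add]
      exact hmid.ge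
    · rw [Function.update_of_ne hk]
      refine ⟨hmem k, ?_⟩
      change 0 ≤ b.coord i (b k) - b.coord j (b k)
      rw [b.coord_apply_ne hk.symm, sub_zero, b.coord_apply]
      split_ifs <;> norm_num
  · rintro x ⟨hx, hle⟩
    rw [b.convexHull_eq_nonneg_coord] at hx
    replace hle : b.coord j x ≤ b.coord i x := sub_nonneg.1 hle
    set w : ι → ℝ := fun k ↦
      b.coord k x + (if k = j then b.coord j x else 0) - (if k = i then b.coord j x else 0)
      with hw
    have hb (k : ι) : Function.update b j (midpoint ℝ (b i) (b j)) k =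
        b k + if k = j then midpoint ℝ (b i) (b j) - b j else 0 := by
      rcases eq_or_ne k j with rfl | hk
      · simp only [Function.update_self, if_true, add_sub_cancel]
      · simp only [Function.update_of_ne hk, if_neg hk, add_zero]
    have hsum : ∑ k, w k • Function.update b j (midpoint ℝ (b i) (b j)) k = x := by
      have hvert : ∑ k, w k • b k = x + b.coord j x • b j - b.coord j x • b i := by
        simp [hw, add_smul, sub_smul, ite_smul, Finset.sum_add_distrib,
          Finset.sum_sub_distrib, b.linear_combination_coord_eq_self]
      have hwj : w j = 2 * b.coord j x := by
        simp [hw, hij.symm, two_mul]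
      simp_rw [hb, smul_add, Finset.sum_add_distrib, hvert, smul_ite, smul_zero,
        Finset.sum_ite_eq', Finset.mem_univ, if_true, hwj, midpoint_eq_smul_add]
      rw [invOf_eq_inv]
      module
    rw [← hsum]
    refine (convex_convexHull ℝ _).sum_mem (fun k _ ↦ ?_) ?_
      (fun k _ ↦ subset_convexHull ℝ _ ⟨k, rfl⟩)
    · have hk := hx k
      have hj := hx j
      simp only [hw]
      split_ifs with h₁ h₂ h₂
      · linarith
      · linarith
      · subst h₂
        linarith
      · linarith
    · simp [hw, Finset.sum_add_distrib, Finset.sum_sub_distrib]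

/-- The children of the bisection are the intersections of the parent with two
complementary half-spaces: there is an affine map `f : ℝⁿ → ℝ` vanishing at
`z = (p₀+p₁)/2` and at `p₂, …, pₙ`, positive at `p₀` and negative at `p₁`, with
`conv{p₀, z, p₂, …, pₙ} = conv{p₀, …, pₙ} ∩ {f ≥ 0}` and
`conv{z, p₁, p₂, …, pₙ} = conv{p₀, …, pₙ} ∩ {f ≤ 0}`. -/
theorem bisection_children_halfspaces (n : ℕ) (hn : 1 ≤ n)
    (p : Fin (n+1) → EuclideanSpace ℝ (Fin n)) (hp : AffineIndependent ℝ p) :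
    ∃ f : EuclideanSpace ℝ (Fin n) →ᵃ[ℝ] ℝ,
      f (midpoint ℝ (p 0) (p 1)) = 0 ∧
      (∀ i : Fin (n+1), i ≠ 0 → i ≠ 1 → f (p i) = 0) ∧
      0 < f (p 0) ∧ f (p 1) < 0 ∧
      convexHull ℝ (Set.range (Function.update p 1 (midpoint ℝ (p 0) (p 1)))) =
        convexHull ℝ (Set.range p) ∩ {x | 0 ≤ f x} ∧
      convexHull ℝ (Set.range (Function.update p 0 (midpoint ℝ (p 0) (p 1)))) =
        convexHull ℝ (Set.range p) ∩ {x | f x ≤ 0} := by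
  have h01 : (0 : Fin (n + 1)) ≠ 1 := by
    have : NeZero n := ⟨by omega⟩
    simp
  let b : AffineBasis (Fin (n + 1)) ℝ (EuclideanSpace ℝ (Fin n)) :=
    ⟨p, hp, hp.affineSpan_eq_top_iff_card_eq_finrank_add_one.2 (by simp)⟩
  have hcoord (i k : Fin (n + 1)) : b.coord i (p k) = if i = k then 1 else 0 := b.coord_apply i k
  refine ⟨b.coord 0 - b.coord 1, ?_, fun i h0 h1 ↦ ?_, ?_, ?_,
    b.convexHull_range_update_midpoint h01, ?_⟩
  · rw [AffineMap.map_midpoint]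
    simp [hcoord, h01, h01.symm, midpoint_eq_smul_add]
  · simp [hcoord, h0.symm, h1.symm]
  · simp [hcoord, h01.symm]
  · simp [hcoord, h01]
  · have h := b.convexHull_range_update_midpoint h01.symm
    rw [midpoint_comm] at h
    refine h.trans ?_
    congr 1
    ext x
    simp
end

section
/- The two children produced by Maubach's bisection are reflected neighbors: let v₀, v₁, …, vₙ be distinct vertices, let 1 ≤ d ≤ n, let z be a new vertex distinct from all vᵢ, and set σ₁ = (v₀, …, v_{d−1}, z, v_{d+1}, …, vₙ) and σ₂ = (v₁, …, v_d, z, v_{d+1}, …, vₙ). Then σ₁ and σ₂ share exactly the n vertices {v₁, …, v_{d−1}, z, v_{d+1}, …, vₙ}, and there exist strictly increasing index sequences i₀ < i₁ < … < i_{n−1} and j₀ < j₁ < … < j_{n−1} in {0, …, n} such that σ₁(i_k) = σ₂(j_k) for k = 0, …, n−1, i.e., the shared face appears in the same vertex order in both children. -/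
/-- The second child of Maubach's bisection of `(v₀, …, vₙ)` with tag `d`:
`σ₂ = (v₁, …, v_d, z, v_{d+1}, …, vₙ)`. -/
def maubachChild2 {V : Type*} {n : ℕ} (v : Fin (n+1) → V) (d : Fin (n+1)) (z : V) :
    Fin (n+1) → V := fun k =>
  if h : (k : ℕ) < (d : ℕ) then v ⟨(k : ℕ) + 1, by have := d.isLt; omega⟩
  else if (k : ℕ) = (d : ℕ) then z else v k

/-- The vertices of the first child are `z` and the old vertices other than `v d`. -/
theorem range_update_eq_insert_image {ι V : Type*} [DecidableEq ι] (v : ι → V) (d : ι) (z : V) :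
    Set.range (Function.update v d z) = insert z (v '' {i | i ≠ d}) := by
  ext x
  constructor
  · rintro ⟨i, rfl⟩
    by_cases h : i = d
    · subst h; simp
    · exact Or.inr ⟨i, h, by simp [h]⟩
  · rintro (rfl | ⟨i, hi, rfl⟩)
    · exact ⟨d, by simp⟩
    · exact ⟨i, Function.update_of_ne hi _ _⟩

/-- The vertices of the second child are `z` and the old vertices other than `v 0`. -/
theorem range_maubachChild2 {V : Type*} {n : ℕ} (v : Fin (n+1) → V) (d : Fin (n+1)) (z : V) :
    Set.range (maubachChild2 v d z) = insert z (v '' {i | i ≠ 0}) := by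
  ext x
  constructor
  · rintro ⟨k, rfl⟩
    unfold maubachChild2
    split_ifs with h h'
    · exact Or.inr ⟨_, fun h₀ => Nat.succ_ne_zero _ (congrArg Fin.val h₀), rfl⟩
    · exact Or.inl rfl
    · refine Or.inr ⟨k, ?_, rfl⟩
      simp only [Set.mem_ofPred_eq, ne_eq, Fin.ext_iff, Fin.val_zero]
      omega
  · rintro (rfl | ⟨i, hi, rfl⟩)
    · exact ⟨d, by simp [maubachChild2]⟩
    · obtain ⟨j, rfl⟩ := Fin.exists_succ_eq.2 hi
      by_cases h : (j : ℕ) < d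
      · exact ⟨j.castSucc, by simp [maubachChild2, h, Fin.succ]⟩
      · refine ⟨j.succ, ?_⟩
        have h₁ : ¬ (j : ℕ) + 1 < d := by omega
        have h₂ : (j : ℕ) + 1 ≠ d := by omega
        simp [maubachChild2, h₁, h₂]

/-- The two children of Maubach's bisection,
`σ₁ = (v₀, …, v_{d−1}, z, v_{d+1}, …, vₙ)` and `σ₂ = (v₁, …, v_d, z, v_{d+1}, …, vₙ)`,
share exactly the `n` vertices `{v₁, …, v_{d−1}, z, v_{d+1}, …, vₙ}`, and there are
strictly increasing index sequences `I`, `J` with `σ₁(I k) = σ₂(J k)` for all `k`: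
the shared face appears in the same vertex order in both children (reflected
neighbors). -/
theorem maubach_children_reflected_neighbors {V : Type*} (n : ℕ) (hn : 1 ≤ n)
    (v : Fin (n+1) → V) (hv : Function.Injective v)
    (d : Fin (n+1)) (hd1 : 1 ≤ (d : ℕ)) (hdn : (d : ℕ) ≤ n)
    (z : V) (hz : z ∉ Set.range v) :
    (Set.range (Function.update v d z) ∩ Set.range (maubachChild2 v d z) =
      insert z (v '' {i : Fin (n+1) | i ≠ 0 ∧ i ≠ d})) ∧
    ∃ I J : Fin n → Fin (n+1), StrictMono I ∧ StrictMono J ∧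
      ∀ k, Function.update v d z (I k) = maubachChild2 v d z (J k) := by
  constructor
  · rw [range_update_eq_insert_image, range_maubachChild2, ← Set.insert_inter_distrib,
      ← Set.image_inter hv]
    congr 2
    ext i
    exact and_comm
  · refine ⟨Fin.succ, fun k => if (k : ℕ) + 1 < d then k.castSucc else k.succ,
      Fin.strictMono_succ, fun a b hab => ?_, fun k => ?_⟩
    · simp only [Fin.lt_def] at hab ⊢
      split_ifs <;> simp <;> omega
    · rcases lt_trichotomy ((k : ℕ) + 1) d with h | h | h
      · have hk : k.succ ≠ d := by simp [Fin.ext_iff, h.ne]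
        have h' : (k : ℕ) < d := by omega
        rw [Function.update_of_ne hk]
        simp [maubachChild2, h, h', Fin.succ]
      · have hk : k.succ = d := by simp [Fin.ext_iff, h]
        simp [maubachChild2, h, hk]
      · have hk : k.succ ≠ d := by simp [Fin.ext_iff, h.ne']
        simp [maubachChild2, h.not_gt, h.ne', hk]
end

section
/- Two n-simplices with disjoint interiors sharing a common face lie on opposite sides of the hyperplane spanned by that face: let q₀, …, q_{n−1} be affinely independent points of ℝⁿ, and let w₁, w₂ be points such that q₀, …, q_{n−1}, w₁ and q₀, …, q_{n−1}, w₂ are each affinely independent and the interiors of T₁ = conv{q₀, …, q_{n−1}, w₁} and T₂ = conv{q₀, …, q_{n−1}, w₂} are disjoint. Then for every affine map f : ℝⁿ → ℝ with f(qᵢ) = 0 for all i and f not identically zero, one has f(w₁)·f(w₂) < 0. -/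
open Set

open Filter Topology in
/-- Moving slightly from the centroid of the face `q` of the simplex with vertices `q, w` towards
a point `v` on the same side of that face as `w`, one enters the interior of the simplex. -/
theorem eventually_lineMap_centroid_mem_interior {n : ℕ} (hn : 1 ≤ n)
    (q : Fin n → EuclideanSpace ℝ (Fin n)) (w v : EuclideanSpace ℝ (Fin n))
    (h : AffineIndependent ℝ (Fin.snoc (α := fun _ => EuclideanSpace ℝ (Fin n)) q w))
    (f : EuclideanSpace ℝ (Fin n) →ᵃ[ℝ] ℝ) (hf0 : ∀ i, f (q i) = 0) (hvw : 0 < f v * f w) :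
    ∀ᶠ t : ℝ in 𝓝[>] 0, AffineMap.lineMap (Finset.univ.centroid ℝ q) v t ∈
      interior (convexHull ℝ
        (Set.range (Fin.snoc (α := fun _ => EuclideanSpace ℝ (Fin n)) q w))) := by
  have hcard : (Finset.univ : Finset (Fin n)).card ≠ 0 := by simp; omega
  have hsum : ∑ i, Finset.univ.centroidWeights ℝ (i : Fin n) = 1 :=
    Finset.univ.sum_centroidWeights_eq_one_of_card_ne_zero ℝ hcard
  have hcentroid (g : EuclideanSpace ℝ (Fin n) →ᵃ[ℝ] ℝ) :
      g (Finset.univ.centroid ℝ q) = ∑ i, (n : ℝ)⁻¹ * g (q i) := by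
    rw [Finset.centroid_def, Finset.map_affineCombination _ _ _ hsum,
      Finset.affineCombination_eq_linear_combination _ _ _ hsum]
    simp
  let b : AffineBasis (Fin (n + 1)) ℝ (EuclideanSpace ℝ (Fin n)) :=
    ⟨_, h, h.affineSpan_eq_top_iff_card_eq_finrank_add_one.2 (by simp)⟩
  have hbq (i : Fin n) : b i.castSucc = q i := Fin.snoc_castSucc (α := fun _ => _) ..
  have hbw : b (Fin.last n) = w := Fin.snoc_last (α := fun _ => _) ..
  have hlast (x) : f x = b.coord (Fin.last n) x * f w := by
    have : f = f w • b.coord (Fin.last n) := by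
      refine AffineMap.ext_on b.tot ?_
      rintro _ ⟨i, rfl⟩
      refine Fin.lastCases ?_ (fun i => ?_) i
      · have hb : b.coord (Fin.last n) w = 1 := by rw [← hbw, b.coord_apply_eq]
        simp [hbw, hb]
      · rw [hbq, hf0, ← hbq]
        simp [b.coord_apply, (Fin.castSucc_lt_last i).ne']
    rw [mul_comm]
    exact DFunLike.congr_fun this x
  change ∀ᶠ t : ℝ in 𝓝[>] 0, _ ∈ interior (convexHull ℝ (Set.range b))
  rw [b.interior_convexHull]
  refine eventually_all.2 fun i => ?_
  refine Fin.lastCases ?_ (fun i => ?_) i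
  · filter_upwards [self_mem_nhdsWithin] with t (ht : 0 < t)
    have hx : f (AffineMap.lineMap (Finset.univ.centroid ℝ q) v t) = t * f v := by
      rw [AffineMap.apply_lineMap, hcentroid f]
      simp [hf0, AffineMap.lineMap_apply]
    rw [hlast] at hx
    have hw : f w ≠ 0 := right_ne_zero_of_mul hvw.ne'
    refine pos_of_mul_pos_left (b := f w * f w) ?_ (mul_self_nonneg _)
    rw [← mul_assoc, hx, mul_assoc]
    exact mul_pos ht hvw
  · have hcont : Continuous fun t : ℝ =>
        b.coord i.castSucc (AffineMap.lineMap (Finset.univ.centroid ℝ q) v t) :=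
      (b.coord i.castSucc).continuous_of_finiteDimensional.comp AffineMap.lineMap_continuous
    refine nhdsWithin_le_nhds (hcont.continuousAt.eventually (lt_mem_nhds ?_))
    beta_reduce
    rw [AffineMap.lineMap_apply_zero, hcentroid]
    simp only [← hbq, b.coord_apply]
    simp
    omega

/-- Two `n`-simplices with disjoint interiors sharing a common face lie on opposite
sides of the hyperplane spanned by that face: if `q₀, …, q_{n−1}, w₁` and
`q₀, …, q_{n−1}, w₂` are affinely independent families whose simplices have disjoint
interiors, then every nonzero affine map `f : ℝⁿ → ℝ` vanishing on the `qᵢ` satisfies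
`f(w₁)·f(w₂) < 0`. -/
theorem opposite_sides_of_shared_face (n : ℕ) (hn : 1 ≤ n)
    (q : Fin n → EuclideanSpace ℝ (Fin n)) (hq : AffineIndependent ℝ q)
    (w₁ w₂ : EuclideanSpace ℝ (Fin n))
    (h1 : AffineIndependent ℝ (Fin.snoc q w₁))
    (h2 : AffineIndependent ℝ (Fin.snoc q w₂))
    (hdisj : interior (convexHull ℝ (Set.range (Fin.snoc q w₁))) ∩
      interior (convexHull ℝ (Set.range (Fin.snoc q w₂))) = ∅)
    (f : EuclideanSpace ℝ (Fin n) →ᵃ[ℝ] ℝ)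
    (hf0 : ∀ i, f (q i) = 0) (hf : ∃ x, f x ≠ 0) :
    f w₁ * f w₂ < 0 := by
  have hne (w : EuclideanSpace ℝ (Fin n))
      (h : AffineIndependent ℝ (Fin.snoc (α := fun _ => EuclideanSpace ℝ (Fin n)) q w)) :
      f w ≠ 0 := by
    intro hw
    obtain ⟨x, hx⟩ := hf
    have hspan := h.affineSpan_eq_top_iff_card_eq_finrank_add_one.2 (by simp)
    have : f = AffineMap.const ℝ _ 0 := by
      refine AffineMap.ext_on hspan ?_
      rintro _ ⟨i, rfl⟩
      refine Fin.lastCases ?_ (fun i => ?_) i <;> simp [hw, hf0]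
    exact hx (by rw [this]; rfl)
  by_contra! hnonneg
  have hpos : 0 < f w₁ * f w₂ := hnonneg.lt_of_ne' (mul_ne_zero (hne w₁ h1) (hne w₂ h2))
  obtain ⟨t, ht⟩ := ((eventually_lineMap_centroid_mem_interior hn q w₁ w₁ h1 f hf0
    (mul_self_pos.2 (hne w₁ h1))).and
    (eventually_lineMap_centroid_mem_interior hn q w₂ w₁ h2 f hf0 hpos)).exists
  exact (Set.eq_empty_iff_forall_notMem.1 hdisj _) ht
end
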